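/- For any measurable estimator θ̂ : ℝ^{2p} → ℝ^p and any c > 0, the Kullback–Leibler risk of the predictive density q_{θ̂,c} satisfies the exact identity R_KL(θ, q_{θ̂,c}) = E_θ‖θ̂(X) − θ1‖² / (2 c σ_Y²) + (p/2)(log c + 1/c − 1) for every θ ∈ ℝ^{2p}. Consequently, for fixed c, q_{θ̂_A,c} has Kullback–Leibler risk no larger than q_{θ̂_B,c} at a parameter θ if and only if E_θ‖θ̂_A(X) − θ1‖² ≤ E_θ‖θ̂_B(X) − θ1‖². -/

import Mathlib

open MeasureTheory Real Set

noncomputable section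

abbrev Ep (p : ℕ) := EuclideanSpace ℝ (Fin p)

/-- Density of `N_p(0, v I_p)` evaluated at `u`. -/
def gdens (p : ℕ) (v : ℝ) (u : Ep p) : ℝ :=
  (2 * Real.pi * v) ^ (-(p : ℝ) / 2) * Real.exp (-‖u‖ ^ 2 / (2 * v))

/-- Joint density of `X = (X1, X2)`. -/
def jointDens (p : ℕ) (σ12 σ22 : ℝ) (θ1 θ2 : Ep p) (x : Ep p × Ep p) : ℝ :=
  gdens p σ12 (x.1 - θ1) * gdens p σ22 (x.2 - θ2)

/-- Kullback–Leibler risk. -/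
def klRisk (p : ℕ) (σ12 σ22 σY2 : ℝ) (θ1 θ2 : Ep p)
    (qhat : Ep p × Ep p → Ep p → ℝ) : ℝ :=
  ∫ x : Ep p × Ep p,
    (∫ y : Ep p, gdens p σY2 (y - θ1) *
      Real.log (gdens p σY2 (y - θ1) / qhat x y)) *
    jointDens p σ12 σ22 θ1 θ2 x

/-- The Gaussian `exp (-b ‖u‖ ^ 2)` is integrable. -/
lemma integrable_exp_neg_mul_sq_norm {p : ℕ} {b : ℝ} (hb : 0 < b) :
    Integrable (fun u : Ep p => Real.exp (-b * ‖u‖ ^ 2)) := by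
  refine not_imp_comm.1 integral_undef ?_
  rw [GaussianFourier.integral_rexp_neg_mul_sq_norm hb]
  positivity

/-- The integrand `‖u‖ ^ 2 * exp (-b ‖u‖ ^ 2)` is integrable. -/
lemma integrable_sq_norm_mul_exp_neg_mul_sq_norm {p : ℕ} {b : ℝ} (hb : 0 < b) :
    Integrable (fun u : Ep p => ‖u‖ ^ 2 * Real.exp (-b * ‖u‖ ^ 2)) := by
  refine ((integrable_exp_neg_mul_sq_norm (p := p) (half_pos hb)).const_mul (2 / b)).mono'
    (by fun_prop) (.of_forall fun u => ?_)
  rw [Real.norm_of_nonneg (by positivity)]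
  have hle : ‖u‖ ^ 2 ≤ 2 / b * Real.exp (b / 2 * ‖u‖ ^ 2) := by
    have h := Real.add_one_le_exp (b / 2 * ‖u‖ ^ 2)
    calc ‖u‖ ^ 2 = 2 / b * (b / 2 * ‖u‖ ^ 2) := by field_simp
      _ ≤ _ := by gcongr; linarith
  calc ‖u‖ ^ 2 * Real.exp (-b * ‖u‖ ^ 2)
      ≤ 2 / b * Real.exp (b / 2 * ‖u‖ ^ 2) * Real.exp (-b * ‖u‖ ^ 2) := by gcongr
    _ = 2 / b * Real.exp (-(b / 2) * ‖u‖ ^ 2) := by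
      rw [mul_assoc, ← Real.exp_add]
      ring_nf

/-- The second moment of the Gaussian `exp (-b ‖u‖ ^ 2)`. -/
lemma integral_sq_norm_mul_exp_neg_mul_sq_norm {p : ℕ} {b : ℝ} (hb : 0 < b) :
    ∫ u : Ep p, ‖u‖ ^ 2 * Real.exp (-b * ‖u‖ ^ 2) =
      p / (2 * b) * (π / b) ^ ((p : ℝ) / 2) := by
  have key := (hasDerivAt_integral_of_dominated_loc_of_deriv_le (μ := (volume : Measure (Ep p)))
    (F := fun (t : ℝ) u => Real.exp (-t * ‖u‖ ^ 2))
    (F' := fun t u => Real.exp (-t * ‖u‖ ^ 2) * (-1 * ‖u‖ ^ 2))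
    (bound := fun u => ‖u‖ ^ 2 * Real.exp (-(b / 2) * ‖u‖ ^ 2))
    (Ioi_mem_nhds (half_lt_self hb)) (.of_forall fun t => by fun_prop)
    (integrable_exp_neg_mul_sq_norm hb) (by fun_prop)
    (.of_forall fun u t ht => ?_)
    (integrable_sq_norm_mul_exp_neg_mul_sq_norm (half_pos hb))
    (.of_forall fun u t _ => ((hasDerivAt_id t).neg.mul_const (‖u‖ ^ 2)).exp)).2
  · have hpow : HasDerivAt (fun t : ℝ => (π / t) ^ ((p : ℝ) / 2))
        (-(p / (2 * b) * (π / b) ^ ((p : ℝ) / 2))) b := by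
      have hinv : HasDerivAt (fun t : ℝ => π / t) (-(π / b ^ 2)) b := by
        have h := (hasDerivAt_inv hb.ne').const_mul π
        simp only [← div_eq_mul_inv] at h
        convert! h using 1
        field_simp
      convert! hinv.rpow_const (p := (p : ℝ) / 2) (.inl (by positivity)) using 1
      rw [Real.rpow_sub_one (by positivity)]
      field_simp
    have heq : (fun t : ℝ => ∫ u : Ep p, Real.exp (-t * ‖u‖ ^ 2)) =ᶠ[nhds b]
        fun t => (π / t) ^ ((p : ℝ) / 2) := by
      filter_upwards [Ioi_mem_nhds hb] with t ht
      rw [GaussianFourier.integral_rexp_neg_mul_sq_norm ht, finrank_euclideanSpace_fin]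
    have h := key.unique (hpow.congr_of_eventuallyEq heq)
    rw [← neg_inj, ← h, ← integral_neg]
    congr with u
    ring
  · have ht' : b / 2 < t := ht
    rw [norm_mul, Real.norm_of_nonneg (Real.exp_pos _).le, norm_mul, norm_neg, norm_one, one_mul,
      Real.norm_of_nonneg (by positivity), mul_comm]
    gcongr

lemma gdens_eq (p : ℕ) (v : ℝ) (u : Ep p) :
    gdens p v u = (2 * π * v) ^ (-(p : ℝ) / 2) * Real.exp (-(1 / (2 * v)) * ‖u‖ ^ 2) := by
  rw [gdens]
  congr 2
  ring

lemma gdens_pos (p : ℕ) {v : ℝ} (hv : 0 < v) (u : Ep p) : 0 < gdens p v u := by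
  rw [gdens]
  positivity

lemma gdens_neg (p : ℕ) (v : ℝ) (u : Ep p) : gdens p v (-u) = gdens p v u := by
  simp [gdens]

lemma continuous_gdens (p : ℕ) (v : ℝ) : Continuous (gdens p v) := by
  unfold gdens
  fun_prop

lemma integrable_gdens (p : ℕ) {v : ℝ} (hv : 0 < v) : Integrable (gdens p v) := by
  simp only [funext (gdens_eq p v)]
  exact (integrable_exp_neg_mul_sq_norm (by positivity)).const_mul _

lemma gdens_normalization (p : ℕ) {v : ℝ} (hv : 0 < v) :
    (2 * π * v) ^ (-(p : ℝ) / 2) * (π / (1 / (2 * v))) ^ ((p : ℝ) / 2) = 1 := by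
  rw [show π / (1 / (2 * v)) = 2 * π * v by field_simp, ← Real.rpow_add (by positivity),
    neg_div, neg_add_cancel, Real.rpow_zero]

lemma integral_gdens (p : ℕ) {v : ℝ} (hv : 0 < v) : ∫ u, gdens p v u = 1 := by
  simp only [gdens_eq]
  rw [integral_const_mul, GaussianFourier.integral_rexp_neg_mul_sq_norm (by positivity),
    finrank_euclideanSpace_fin, gdens_normalization p hv]

lemma integrable_gdens_mul_sq_norm (p : ℕ) {v : ℝ} (hv : 0 < v) :
    Integrable (fun u => gdens p v u * ‖u‖ ^ 2) := by
  refine ((integrable_sq_norm_mul_exp_neg_mul_sq_norm (p := p)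
    (b := 1 / (2 * v)) (by positivity)).const_mul ((2 * π * v) ^ (-(p : ℝ) / 2))).congr
    (.of_forall fun u => ?_)
  simp only [gdens_eq]
  ring

lemma integral_gdens_mul_sq_norm (p : ℕ) {v : ℝ} (hv : 0 < v) :
    ∫ u, gdens p v u * ‖u‖ ^ 2 = p * v := by
  calc ∫ u, gdens p v u * ‖u‖ ^ 2
      = ∫ u : Ep p, (2 * π * v) ^ (-(p : ℝ) / 2) *
          (‖u‖ ^ 2 * Real.exp (-(1 / (2 * v)) * ‖u‖ ^ 2)) := by
        congr with u
        rw [gdens_eq]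
        ring
    _ = p * v * ((2 * π * v) ^ (-(p : ℝ) / 2) * (π / (1 / (2 * v))) ^ ((p : ℝ) / 2)) := by
        rw [integral_const_mul, integral_sq_norm_mul_exp_neg_mul_sq_norm (by positivity)]
        field_simp
    _ = p * v := by rw [gdens_normalization p hv, mul_one]

lemma integrable_gdens_mul_sq_norm_add (p : ℕ) {v : ℝ} (hv : 0 < v) (a : Ep p) :
    Integrable (fun u => gdens p v u * ‖u + a‖ ^ 2) := by
  refine (((integrable_gdens_mul_sq_norm p hv).const_mul 2).add
    ((integrable_gdens p hv).const_mul (2 * ‖a‖ ^ 2))).mono'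
    ((continuous_gdens p v).mul (by fun_prop)).aestronglyMeasurable (.of_forall fun u => ?_)
  have hg := gdens_pos p hv u
  have hpar := parallelogram_law_with_norm ℝ u a
  rw [Real.norm_of_nonneg (by positivity)]
  simp only [Pi.add_apply]
  nlinarith [mul_nonneg hg.le (sq_nonneg ‖u - a‖)]

lemma integral_gdens_mul_sq_norm_add (p : ℕ) {v : ℝ} (hv : 0 < v) (a : Ep p) :
    ∫ u, gdens p v u * ‖u + a‖ ^ 2 = p * v + ‖a‖ ^ 2 := by
  have hneg : ∫ u, gdens p v u * ‖u - a‖ ^ 2 = ∫ u, gdens p v u * ‖u + a‖ ^ 2 := by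
    rw [← integral_neg_eq_self]
    congr with u
    rw [gdens_neg, ← norm_neg (-u - a), neg_sub, sub_neg_eq_add, add_comm]
  have hint : Integrable (fun u => gdens p v u * ‖u - a‖ ^ 2) := by
    simpa only [sub_eq_add_neg] using integrable_gdens_mul_sq_norm_add p hv (-a)
  have hsum : ∫ u, (gdens p v u * ‖u + a‖ ^ 2 + gdens p v u * ‖u - a‖ ^ 2) =
      ∫ u, (2 * (gdens p v u * ‖u‖ ^ 2) + 2 * ‖a‖ ^ 2 * gdens p v u) := by
    congr with u
    linear_combination gdens p v u * parallelogram_law_with_norm ℝ u a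
  rw [integral_add (integrable_gdens_mul_sq_norm_add p hv a) hint, hneg,
    integral_add ((integrable_gdens_mul_sq_norm p hv).const_mul _)
      ((integrable_gdens p hv).const_mul _),
    integral_const_mul, integral_const_mul, integral_gdens_mul_sq_norm p hv,
    integral_gdens p hv] at hsum
  linarith

lemma log_gdens (p : ℕ) {v : ℝ} (hv : 0 < v) (u : Ep p) :
    Real.log (gdens p v u) = -(p : ℝ) / 2 * Real.log (2 * π * v) - ‖u‖ ^ 2 / (2 * v) := by
  rw [gdens, Real.log_mul (by positivity) (Real.exp_pos _).ne', Real.log_exp,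
    Real.log_rpow (by positivity)]
  ring

/-- Kullback–Leibler divergence from `N_p(θ, v I_p)` to `N_p(t, c v I_p)`. -/
lemma integral_gdens_mul_log_div (p : ℕ) {v c : ℝ} (hv : 0 < v) (hc : 0 < c) (θ t : Ep p) :
    ∫ y, gdens p v (y - θ) * Real.log (gdens p v (y - θ) / gdens p (c * v) (y - t)) =
      ‖t - θ‖ ^ 2 / (2 * c * v) + (p : ℝ) / 2 * (Real.log c + 1 / c - 1) := by
  rw [← integral_add_right_eq_self _ θ]
  calc ∫ u, gdens p v (u + θ - θ) *
        Real.log (gdens p v (u + θ - θ) / gdens p (c * v) (u + θ - t))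
      = ∫ u, ((p : ℝ) / 2 * Real.log c * gdens p v u
          - 1 / (2 * v) * (gdens p v u * ‖u‖ ^ 2)
          + 1 / (2 * (c * v)) * (gdens p v u * ‖u + (θ - t)‖ ^ 2)) := by
        congr with u
        rw [add_sub_cancel_right, add_sub_assoc,
          Real.log_div (gdens_pos p hv _).ne' (gdens_pos p (mul_pos hc hv) _).ne',
          log_gdens p hv, log_gdens p (mul_pos hc hv),
          show 2 * π * (c * v) = c * (2 * π * v) by ring,
          Real.log_mul hc.ne' (by positivity)]
        ring
    _ = (p : ℝ) / 2 * Real.log c - 1 / (2 * v) * (p * v)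
          + 1 / (2 * (c * v)) * (p * v + ‖θ - t‖ ^ 2) := by
        have h₀ := (integrable_gdens p hv).const_mul ((p : ℝ) / 2 * Real.log c)
        have h₁ := (integrable_gdens_mul_sq_norm p hv).const_mul (1 / (2 * v))
        have h₂ := (integrable_gdens_mul_sq_norm_add p hv (θ - t)).const_mul (1 / (2 * (c * v)))
        have h₀₁ : Integrable (fun u => (p : ℝ) / 2 * Real.log c * gdens p v u
            - 1 / (2 * v) * (gdens p v u * ‖u‖ ^ 2)) := h₀.sub h₁
        rw [integral_add h₀₁ h₂, integral_sub h₀ h₁, integral_const_mul,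
          integral_const_mul, integral_const_mul, integral_gdens p hv,
          integral_gdens_mul_sq_norm p hv, integral_gdens_mul_sq_norm_add p hv, mul_one]
    _ = _ := by
        rw [norm_sub_rev θ t]
        field_simp
        ring

lemma integrable_jointDens (p : ℕ) {σ12 σ22 : ℝ} (hσ1 : 0 < σ12) (hσ2 : 0 < σ22)
    (θ1 θ2 : Ep p) : Integrable (jointDens p σ12 σ22 θ1 θ2) :=
  ((integrable_gdens p hσ1).comp_sub_right θ1).mul_prod
    ((integrable_gdens p hσ2).comp_sub_right θ2)

lemma integral_jointDens (p : ℕ) {σ12 σ22 : ℝ} (hσ1 : 0 < σ12) (hσ2 : 0 < σ22)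
    (θ1 θ2 : Ep p) : ∫ x, jointDens p σ12 σ22 θ1 θ2 x = 1 := by
  simp only [jointDens]
  rw [Measure.volume_eq_prod,
    integral_prod_mul (fun x => gdens p σ12 (x - θ1)) (fun x => gdens p σ22 (x - θ2)),
    integral_sub_right_eq_self, integral_sub_right_eq_self, integral_gdens p hσ1,
    integral_gdens p hσ2, one_mul]

lemma klRisk_gdens (p : ℕ) {σ12 σ22 σY2 c : ℝ} (hσ1 : 0 < σ12) (hσ2 : 0 < σ22)
    (hσY : 0 < σY2) (hc : 0 < c) (θ1 θ2 : Ep p) {θhat : Ep p × Ep p → Ep p}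
    (hint : Integrable (fun x => ‖θhat x - θ1‖ ^ 2 * jointDens p σ12 σ22 θ1 θ2 x)) :
    klRisk p σ12 σ22 σY2 θ1 θ2 (fun x y => gdens p (c * σY2) (y - θhat x)) =
      (∫ x, ‖θhat x - θ1‖ ^ 2 * jointDens p σ12 σ22 θ1 θ2 x) / (2 * c * σY2) +
        (p : ℝ) / 2 * (Real.log c + 1 / c - 1) := by
  simp only [klRisk, integral_gdens_mul_log_div p hσY hc, add_mul,
    div_mul_eq_mul_div _ _ (jointDens _ _ _ _ _ _)]
  rw [integral_add (hint.div_const _) ((integrable_jointDens p hσ1 hσ2 θ1 θ2).const_mul _),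
    integral_div, integral_const_mul, integral_jointDens p hσ1 hσ2, mul_one]

/-- Exact Kullback–Leibler risk identity for plug-in type predictive densities
`N_p(θ̂(X), c σY² I_p)`, and the resulting mean-squared-error duality. -/
theorem stmt2 (p : ℕ) (σ12 σ22 σY2 : ℝ)
    (hσ1 : 0 < σ12) (hσ2 : 0 < σ22) (hσY : 0 < σY2)
    (c : ℝ) (hc : 0 < c) (θ1 θ2 : Ep p) :
    (∀ θhat : Ep p × Ep p → Ep p, Measurable θhat →
      Integrable (fun x : Ep p × Ep p =>
        ‖θhat x - θ1‖ ^ 2 * jointDens p σ12 σ22 θ1 θ2 x) →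
      klRisk p σ12 σ22 σY2 θ1 θ2 (fun x y => gdens p (c * σY2) (y - θhat x)) =
        (∫ x : Ep p × Ep p, ‖θhat x - θ1‖ ^ 2 * jointDens p σ12 σ22 θ1 θ2 x) /
          (2 * c * σY2) +
        (p : ℝ) / 2 * (Real.log c + 1 / c - 1)) ∧
    (∀ θhatA θhatB : Ep p × Ep p → Ep p, Measurable θhatA → Measurable θhatB →
      Integrable (fun x : Ep p × Ep p =>
        ‖θhatA x - θ1‖ ^ 2 * jointDens p σ12 σ22 θ1 θ2 x) →
      Integrable (fun x : Ep p × Ep p =>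
        ‖θhatB x - θ1‖ ^ 2 * jointDens p σ12 σ22 θ1 θ2 x) →
      (klRisk p σ12 σ22 σY2 θ1 θ2 (fun x y => gdens p (c * σY2) (y - θhatA x)) ≤
        klRisk p σ12 σ22 σY2 θ1 θ2 (fun x y => gdens p (c * σY2) (y - θhatB x)) ↔
      (∫ x : Ep p × Ep p, ‖θhatA x - θ1‖ ^ 2 * jointDens p σ12 σ22 θ1 θ2 x) ≤
        (∫ x : Ep p × Ep p, ‖θhatB x - θ1‖ ^ 2 * jointDens p σ12 σ22 θ1 θ2 x))) := by
  refine ⟨fun θhat _ hint => klRisk_gdens p hσ1 hσ2 hσY hc θ1 θ2 hint,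
    fun θhatA θhatB _ _ hA hB => ?_⟩
  rw [klRisk_gdens p hσ1 hσ2 hσY hc θ1 θ2 hA, klRisk_gdens p hσ1 hσ2 hσY hc θ1 θ2 hB,
    add_le_add_iff_right, div_le_div_iff_of_pos_right (by positivity)]

end
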